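/- Let (Ω, F, μ) be a probability space, n a positive integer, K, Q, R n×n complex matrices, g₀ ∈ ℂⁿ a fixed vector, and e, w : ℕ → Ω → ℂⁿ sequences of random vectors. Define y : ℕ → Ω → ℂⁿ by y_0(ω) = g₀ and y_{t+1}(ω) = K y_t(ω) + e_t(ω), and define the noisy observations h_t(ω) = y_t(ω) + w_t(ω). Assume E[e_t] = 0 and E[w_t] = 0 for every t; E[e_{t'} e_tᴴ] = 0 for t' ≠ t; E[w_{t'} w_tᴴ] = Q if t' = t and 0 otherwise; E[e_{t'} w_tᴴ] = R if t' = t and 0 otherwise; all outer products appearing are integrable; and additionally there is an n×n complex matrix G with E[y_t y_tᴴ] = G for every t. Then for every t ∈ ℕ: E[h_{t+τ} h_tᴴ] = K^{τ-1}(K G + R) for every integer τ ≥ 1, and E[h_t h_tᴴ] = G + Q. -/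

import Mathlib

open Matrix MeasureTheory

section crossMoment

variable {Ω : Type*} [MeasurableSpace Ω] {n : ℕ}

/-- The matrix `E[u vᴴ]` of entrywise expectations of the outer product of `u` and `v`. -/
noncomputable def crossMoment (μ : Measure Ω) (u v : Ω → Fin n → ℂ) :
    Matrix (Fin n) (Fin n) ℂ :=
  Matrix.of fun i j => ∫ ω, u ω i * star (v ω j) ∂μ

/-- All entries of the outer product `u vᴴ` are integrable. -/
def IntegrableOuter (μ : Measure Ω) (u v : Ω → Fin n → ℂ) : Prop :=
  ∀ i j, Integrable (fun ω => u ω i * star (v ω j)) μ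

variable {μ : Measure Ω} {a b u v : Ω → Fin n → ℂ}

theorem crossMoment_conjTranspose : (crossMoment μ u v)ᴴ = crossMoment μ v u := by
  ext i j
  simp only [crossMoment, conjTranspose_apply, of_apply, ← starRingEnd_apply]
  rw [← integral_conj]
  simp [mul_comm]

theorem crossMoment_mulVec_add_left (K : Matrix (Fin n) (Fin n) ℂ)
    (hb : ∀ ω, b ω = K.mulVec (u ω) + a ω)
    (hu : IntegrableOuter μ u v) (ha : IntegrableOuter μ a v) :
    crossMoment μ b v = K * crossMoment μ u v + crossMoment μ a v := by
  ext i j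
  simp only [crossMoment, Matrix.add_apply, mul_apply, of_apply]
  have hexp : ∀ ω, b ω i * star (v ω j)
      = ∑ k, K i k * (u ω k * star (v ω j)) + a ω i * star (v ω j) := by
    intro ω
    simp only [hb, Pi.add_apply, mulVec, dotProduct, add_mul, Finset.sum_mul, mul_assoc]
  simp only [hexp]
  rw [integral_add (integrable_finsetSum _ fun k _ => (hu k j).const_mul _) (ha i j),
    integral_finsetSum _ fun k _ => (hu k j).const_mul _]
  simp only [integral_const_mul]

theorem crossMoment_add_left (hb : ∀ ω, b ω = u ω + a ω)
    (hu : IntegrableOuter μ u v) (ha : IntegrableOuter μ a v) :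
    crossMoment μ b v = crossMoment μ u v + crossMoment μ a v := by
  simpa using crossMoment_mulVec_add_left 1 (by simpa using hb) hu ha

theorem IntegrableOuter.add_left (hb : ∀ ω, b ω = u ω + a ω)
    (hu : IntegrableOuter μ u v) (ha : IntegrableOuter μ a v) : IntegrableOuter μ b v := by
  intro i j
  simp only [hb, Pi.add_apply, add_mul]
  exact (hu i j).add (ha i j)

theorem IntegrableOuter.swap (huv : IntegrableOuter μ u v) : IntegrableOuter μ v u := by
  intro i j
  refine (Complex.conjCLE.toContinuousLinearMap.integrable_comp (huv j i)).congr
    (.of_forall fun ω => ?_)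
  simp [mul_comm]

theorem crossMoment_add_right (hb : ∀ ω, b ω = u ω + a ω)
    (hu : IntegrableOuter μ v u) (ha : IntegrableOuter μ v a) :
    crossMoment μ v b = crossMoment μ v u + crossMoment μ v a := by
  rw [← crossMoment_conjTranspose, crossMoment_add_left hb hu.swap ha.swap,
    conjTranspose_add, crossMoment_conjTranspose, crossMoment_conjTranspose]

theorem crossMoment_const_left_eq_zero (c : Fin n → ℂ) (hu : ∀ ω, u ω = c)
    (hv : ∀ i, ∫ ω, v ω i ∂μ = 0) : crossMoment μ u v = 0 := by
  ext i j
  simp only [crossMoment, of_apply, hu, Matrix.zero_apply, integral_const_mul, ← starRingEnd_apply]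
  rw [integral_conj, hv]
  simp

/-- A linear process driven by noise that is uncorrelated with `v` before time `m` is itself
uncorrelated with `v` up to time `m`. -/
theorem crossMoment_linear_process_eq_zero {K : Matrix (Fin n) (Fin n) ℂ}
    {y e : ℕ → Ω → Fin n → ℂ} (c : Fin n → ℂ) (hy0 : ∀ ω, y 0 ω = c)
    (hyrec : ∀ t ω, y (t + 1) ω = K.mulVec (y t ω) + e t ω)
    (hv : ∀ i, ∫ ω, v ω i ∂μ = 0)
    (hyv : ∀ t, IntegrableOuter μ (y t) v) (hev : ∀ t, IntegrableOuter μ (e t) v)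
    {m : ℕ} (hm : ∀ t < m, crossMoment μ (e t) v = 0) :
    ∀ t ≤ m, crossMoment μ (y t) v = 0 := by
  intro t
  induction t with
  | zero => exact fun _ => crossMoment_const_left_eq_zero c hy0 hv
  | succ t ih =>
    intro ht
    rw [crossMoment_mulVec_add_left K (hyrec t) (hyv t) (hev t), ih (by omega), hm t (by omega)]
    simp

/-- If `e t` is uncorrelated with `v` for `t > s`, then `E[y_{s+1+k} vᴴ] = K ^ k E[y_{s+1} vᴴ]`. -/
theorem crossMoment_linear_process_add {K : Matrix (Fin n) (Fin n) ℂ}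
    {y e : ℕ → Ω → Fin n → ℂ}
    (hyrec : ∀ t ω, y (t + 1) ω = K.mulVec (y t ω) + e t ω)
    (hyv : ∀ t, IntegrableOuter μ (y t) v) (hev : ∀ t, IntegrableOuter μ (e t) v)
    {s : ℕ} (hs : ∀ t, s < t → crossMoment μ (e t) v = 0) (k : ℕ) :
    crossMoment μ (y (s + 1 + k)) v = K ^ k * crossMoment μ (y (s + 1)) v := by
  induction k with
  | zero => simp
  | succ k ih =>
    rw [← add_assoc, crossMoment_mulVec_add_left K (hyrec _) (hyv _) (hev _), ih,
      hs _ (by omega), add_zero, pow_succ', Matrix.mul_assoc]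

end crossMoment

/-- Lemma 2 of the paper, case `t' > t`: the second-moment matrices
`H_{t',t} = E[h_{t'} h_tᴴ]` of the noisy observations `h t = y t + w t`, where
`y (t+1) = K y t + e t`, with zero-mean white process noise `e`, zero-mean white
observation noise `w` of covariance `Q`, and cross-covariance `E[e_t w_tᴴ] = R`,
and additionally stationary second moment `E[y_t y_tᴴ] = G`, satisfy
`E[h_{t+τ} h_tᴴ] = K^(τ-1) (K G + R)` for `τ ≥ 1` and `E[h_t h_tᴴ] = G + Q`.
Expectations of outer products are taken entrywise. (Corollary to Lemma 2.) -/
theorem stmt_10 {Ω : Type*} [MeasurableSpace Ω] (μ : Measure Ω) [IsProbabilityMeasure μ]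
    (n : ℕ) (hn : 0 < n) (K Q R : Matrix (Fin n) (Fin n) ℂ) (g0 : Fin n → ℂ)
    (e w y h : ℕ → Ω → Fin n → ℂ)
    (hy0 : ∀ ω, y 0 ω = g0)
    (hyrec : ∀ t ω, y (t + 1) ω = K.mulVec (y t ω) + e t ω)
    (hh : ∀ t ω, h t ω = y t ω + w t ω)
    (he_int : ∀ t i, Integrable (fun ω => e t ω i) μ)
    (he_mean : ∀ t i, ∫ ω, e t ω i ∂μ = 0)
    (hw_int : ∀ t i, Integrable (fun ω => w t ω i) μ)
    (hw_mean : ∀ t i, ∫ ω, w t ω i ∂μ = 0)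
    (hee_int : ∀ t' t i j, Integrable (fun ω => e t' ω i * star (e t ω j)) μ)
    (hee : ∀ t' t, t' ≠ t → ∀ i j, ∫ ω, e t' ω i * star (e t ω j) ∂μ = 0)
    (hww_int : ∀ t' t i j, Integrable (fun ω => w t' ω i * star (w t ω j)) μ)
    (hww : ∀ t' t, (Matrix.of fun i j => ∫ ω, w t' ω i * star (w t ω j) ∂μ)
      = if t' = t then Q else 0)
    (hew_int : ∀ t' t i j, Integrable (fun ω => e t' ω i * star (w t ω j)) μ)
    (hew : ∀ t' t, (Matrix.of fun i j => ∫ ω, e t' ω i * star (w t ω j) ∂μ)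
      = if t' = t then R else 0)
    (hyy_int : ∀ t' t i j, Integrable (fun ω => y t' ω i * star (y t ω j)) μ)
    (hye_int : ∀ t' t i j, Integrable (fun ω => y t' ω i * star (e t ω j)) μ)
    (hey_int : ∀ t' t i j, Integrable (fun ω => e t' ω i * star (y t ω j)) μ)
    (hyw_int : ∀ t' t i j, Integrable (fun ω => y t' ω i * star (w t ω j)) μ)
    (hwy_int : ∀ t' t i j, Integrable (fun ω => w t' ω i * star (y t ω j)) μ)
    (hhh_int : ∀ t' t i j, Integrable (fun ω => h t' ω i * star (h t ω j)) μ)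
    (G : Matrix (Fin n) (Fin n) ℂ)
    (hstat : ∀ t, (Matrix.of fun i j => ∫ ω, y t ω i * star (y t ω j) ∂μ) = G) :
    ∀ t : ℕ,
      (∀ τ : ℕ, 1 ≤ τ →
        (Matrix.of fun i j => ∫ ω, h (t + τ) ω i * star (h t ω j) ∂μ)
          = K ^ (τ - 1) * (K * G + R)) ∧
      (Matrix.of fun i j => ∫ ω, h t ω i * star (h t ω j) ∂μ) = G + Q := by
  change ∀ t' t, crossMoment μ (w t') (w t) = _ at hww
  change ∀ t' t, crossMoment μ (e t') (w t) = _ at hew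
  change ∀ t, crossMoment μ (y t) (y t) = G at hstat
  have hee' : ∀ t' t, t' ≠ t → crossMoment μ (e t') (e t) = 0 := fun t' t ht => by
    ext i j
    exact hee t' t ht i j
  have hyw : ∀ s t, s ≤ t → crossMoment μ (y s) (w t) = 0 := fun s t =>
    crossMoment_linear_process_eq_zero g0 hy0 hyrec (hw_mean t) (fun s => hyw_int s t)
      (fun s => hew_int s t) (fun s hs => by rw [hew, if_neg hs.ne]) s
  have hwy : ∀ s t, t ≤ s → crossMoment μ (w s) (y t) = 0 := fun s t hts => by
    rw [← crossMoment_conjTranspose, hyw t s hts, conjTranspose_zero]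
  have hey : ∀ s t, t ≤ s → crossMoment μ (e s) (y t) = 0 := fun s t hts => by
    rw [← crossMoment_conjTranspose,
      crossMoment_linear_process_eq_zero g0 hy0 hyrec (he_mean s) (fun t => hye_int t s)
        (fun t => hee_int t s) (fun t ht => hee' t s ht.ne) t hts, conjTranspose_zero]
  have hsplit : ∀ s t, crossMoment μ (h s) (h t)
      = crossMoment μ (y s) (y t) + crossMoment μ (w s) (y t)
        + (crossMoment μ (y s) (w t) + crossMoment μ (w s) (w t)) := fun s t => by
    rw [crossMoment_add_right (hh t)
        (IntegrableOuter.add_left (hh s) (hyy_int s t) (hwy_int s t))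
        (IntegrableOuter.add_left (hh s) (hyw_int s t) (hww_int s t)),
      crossMoment_add_left (hh s) (hyy_int s t) (hwy_int s t),
      crossMoment_add_left (hh s) (hyw_int s t) (hww_int s t)]
  intro t
  refine ⟨fun τ hτ => ?_, ?_⟩
  · change crossMoment μ (h (t + τ)) (h t) = _
    obtain ⟨k, rfl⟩ := Nat.exists_eq_add_of_le hτ
    have hyy_lag : crossMoment μ (y (t + 1 + k)) (y t) = K ^ k * (K * G) := by
      rw [crossMoment_linear_process_add hyrec (fun s => hyy_int s t) (fun s => hey_int s t)
          (fun s hs => hey s t hs.le),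
        crossMoment_mulVec_add_left K (hyrec t) (hyy_int t t) (hey_int t t), hstat,
        hey t t le_rfl, add_zero]
    have hyw_lag : crossMoment μ (y (t + 1 + k)) (w t) = K ^ k * R := by
      rw [crossMoment_linear_process_add hyrec (fun s => hyw_int s t) (fun s => hew_int s t)
          (fun s hs => by rw [hew, if_neg hs.ne']),
        crossMoment_mulVec_add_left K (hyrec t) (hyw_int t t) (hew_int t t),
        hyw t t le_rfl, hew, if_pos rfl, Matrix.mul_zero, zero_add]
    rw [← add_assoc, hsplit, hyy_lag, hyw_lag, hwy _ _ (by omega), hww, if_neg (by omega),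
      add_zero, add_zero, Nat.add_sub_cancel_left, Matrix.mul_add]
  · change crossMoment μ (h t) (h t) = _
    rw [hsplit, hstat, hwy t t le_rfl, hyw t t le_rfl, hww, if_pos rfl, add_zero, zero_add]
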